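/- There is a constant C > 0 such that for all sufficiently large m and all integers n with 1 ≤ n ≤ m, s(m,n,3) ≤ C · √(m · n · log₂(2m/n)). -/

import Mathlib

/-- A Boolean decision tree over an `s`-bit memory: each internal node probes a
bit at an index in `[s]`, each leaf is marked Yes (`true`) or No (`false`). -/
inductive DTree (s : ℕ) : Type
  | leaf (b : Bool) : DTree s
  | node (i : Fin s) (f0 f1 : DTree s) : DTree s

/-- Depth of a decision tree. -/
def DTree.depth {s : ℕ} : DTree s → ℕ
  | .leaf _ => 0
  | .node _ f0 f1 => max f0.depth f1.depth + 1

/-- Evaluating a decision tree on a memory `σ : Fin s → Bool`: at a node probing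
index `i`, follow the edge labeled by the bit `σ i`. -/
def DTree.eval {s : ℕ} : DTree s → (Fin s → Bool) → Bool
  | .leaf b, _ => b
  | .node i f0 f1, σ => if σ i then f1.eval σ else f0.eval σ

/-- An `(m,n,s,t)`-scheme: a storing scheme `φ` mapping subsets of `[m]` of size at
most `n` to `s`-bit strings, together with a family of decision trees of depth at
most `t` answering membership queries correctly. -/
def SchemeExists (m n s t : ℕ) : Prop :=
  ∃ (φ : Finset (Fin m) → (Fin s → Bool)) (T : Fin m → DTree s),
    (∀ u : Fin m, (T u).depth ≤ t) ∧
    ∀ S : Finset (Fin m), S.card ≤ n → ∀ u : Fin m, ((T u).eval (φ S) = true ↔ u ∈ S)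

/-- `sFun m n t` is the minimum `s` such that an `(m,n,s,t)`-scheme exists. -/
noncomputable def sFun (m n t : ℕ) : ℕ := sInf {s : ℕ | SchemeExists m n s t}

/-- The cells, one in each of seven tables of size `s`, attached to a tuple of positions. -/
def cells {s : ℕ} (g : Fin 7 → Fin s) : Finset (Fin 7 × Fin s) :=
  Finset.univ.image fun j => (j, g j)

lemma mem_cells {s : ℕ} {g : Fin 7 → Fin s} {v : Fin 7 × Fin s} :
    v ∈ cells g ↔ g v.1 = v.2 := by
  simp only [cells, Finset.mem_image, Finset.mem_univ, true_and]
  constructor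
  · rintro ⟨j, rfl⟩; rfl
  · intro h; exact ⟨v.1, by rw [h]⟩

/-- All the cells attached to the elements of `X`. -/
def nbhd {m s : ℕ} (h : Fin m → Fin 7 → Fin s) (X : Finset (Fin m)) : Finset (Fin 7 × Fin s) :=
  X.biUnion fun x => cells (h x)

lemma mem_nbhd {m s : ℕ} {h : Fin m → Fin 7 → Fin s} {X : Finset (Fin m)} {v : Fin 7 × Fin s} :
    v ∈ nbhd h X ↔ ∃ x ∈ X, h x v.1 = v.2 := by
  simp [nbhd, mem_cells]

/-- Any set of elements, each of which shares a cell with a set `S` of size at most `n`,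
has at least five times as many cells as elements. -/
def Admissible {m s : ℕ} (n : ℕ) (h : Fin m → Fin 7 → Fin s) : Prop :=
  ∀ S : Finset (Fin m), S.card ≤ n → ∀ X : Finset (Fin m),
    (∀ x ∈ X, ∃ j, (j, h x j) ∈ nbhd h S) → 5 * X.card ≤ (nbhd h X).card

/-- The complete depth-three tree whose nodes are numbered in breadth-first order. -/
def queryTree {r : ℕ} (c : Fin 7 → Fin r) : DTree r :=
  .node (c 0)
    (.node (c 1) (.node (c 3) (.leaf false) (.leaf true)) (.node (c 4) (.leaf false) (.leaf true)))
    (.node (c 2) (.node (c 5) (.leaf false) (.leaf true)) (.node (c 6) (.leaf false) (.leaf true)))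

/-- The answer of `queryTree` when its nodes read the bits `g`. -/
def answer (g : Fin 7 → Bool) : Bool :=
  if g 0 then (if g 2 then g 6 else g 5) else (if g 1 then g 4 else g 3)

lemma queryTree_depth {r : ℕ} (c : Fin 7 → Fin r) : (queryTree c).depth ≤ 3 := by
  simp [queryTree, DTree.depth]

lemma queryTree_eval {r : ℕ} (c : Fin 7 → Fin r) (σ : Fin r → Bool) :
    (queryTree c).eval σ = answer fun j => σ (c j) := by
  have hb : ∀ b : Bool, (if b = true then true else false) = b := by decide
  simp only [queryTree, DTree.eval, answer, hb]

/-- Whether at least two of three bits are set. -/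
def twoOf (a b c : Bool) : Bool := (a && b) || (a && c) || (b && c)

/-- The bits that an element owning the nodes `o` writes in order to obtain the answer `b`. -/
def steer (o : Fin 7 → Bool) (b : Bool) (j : Fin 7) : Bool :=
  if j = 0 then !twoOf (o 1) (o 3) (o 4)
  else if j = 1 then o 4
  else if j = 2 then o 6
  else b

lemma steer_leaf (o : Fin 7 → Bool) (b : Bool) {j : Fin 7} (hj : 3 ≤ j) : steer o b j = b := by
  unfold steer
  rw [if_neg, if_neg, if_neg] <;> rintro rfl <;> revert hj <;> decide

lemma answer_eq_of_steer (o g : Fin 7 → Bool) (b : Bool)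
    (ho : 5 ≤ (Finset.univ.filter fun j => o j = true).card)
    (hg : ∀ j, o j = true → g j = steer o b j) : answer g = b := by
  have side : ∀ x y z p q r d : Bool, twoOf x y z = true → (x = true → p = z) →
      (y = true → q = d) → (z = true → r = d) → (if p then r else q) = d := by decide
  have count : ∀ f : Fin 7 → Bool, 5 ≤ (Finset.univ.filter fun j => f j = true).card →
      twoOf (f 0) (twoOf (f 1) (f 3) (f 4)) (twoOf (f 2) (f 5) (f 6)) = true := by
    intro f hf
    have H : ∀ a b c d e p q : Bool, 5 ≤ a.toNat + b.toNat + c.toNat + d.toNat + e.toNat +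
        p.toNat + q.toNat → twoOf a (twoOf b d e) (twoOf c p q) = true := by decide
    refine H _ _ _ _ _ _ _ ?_
    rw [Finset.card_filter, Fin.sum_univ_seven] at hf
    simpa only [Bool.toNat, Bool.cond_eq_ite] using hf
  have h0 := hg 0
  have left := side (o 1) (o 3) (o 4) (g 1) (g 3) (g 4) b
  have right := side (o 2) (o 5) (o 6) (g 2) (g 5) (g 6) b
  have c := count o ho
  have l := fun H => left H (hg 1) (hg 3) (hg 4)
  have r := fun H => right H (hg 2) (hg 5) (hg 6)
  have root : ∀ x y z p u v d : Bool, twoOf x y z = true → (x = true → p = !y) →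
      (y = true → u = d) → (z = true → v = d) → (if p then v else u) = d := by decide
  exact root _ _ _ _ _ _ _ c h0 l r

lemma Admissible.schemeExists {m s n : ℕ} {h : Fin m → Fin 7 → Fin s} (hh : Admissible n h) :
    SchemeExists m n (7 * s) 3 := by
  classical
  have key : ∀ S : Finset (Fin m), S.card ≤ n → ∃ σ : Fin 7 × Fin s → Bool,
      ∀ u, answer (fun j => σ (j, h u j)) = decide (u ∈ S) := by
    intro S hS
    let B : Finset (Fin m) := Finset.univ.filter fun x => ∃ j, (j, h x j) ∈ nbhd h S
    have hall : ∃ f : B × Fin 5 → Fin 7 × Fin s, Function.Injective f ∧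
        ∀ p, f p ∈ cells (h p.1) := by
      rw [← Finset.all_card_le_biUnion_card_iff_exists_injective
        (fun p : B × Fin 5 => cells (h p.1))]
      intro A
      let X : Finset (Fin m) := A.image fun p => (p.1 : Fin m)
      have hX := hh S hS X (by
        intro x hx
        obtain ⟨p, -, rfl⟩ := Finset.mem_image.mp hx
        exact (Finset.mem_filter.mp p.1.2).2)
      have hcard : A.card ≤ 5 * X.card := by
        have : A.card ≤ (X ×ˢ (Finset.univ : Finset (Fin 5))).card := by
          refine Finset.card_le_card_of_injOn (fun p => ((p.1 : Fin m), p.2)) ?_ ?_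
          · intro p hp
            exact Finset.mem_product.mpr ⟨Finset.mem_image.mpr ⟨p, hp, rfl⟩, Finset.mem_univ _⟩
          · rintro ⟨p, i⟩ - ⟨q, j⟩ - hpq
            simp only [Prod.mk.injEq] at hpq
            exact Prod.ext (Subtype.ext hpq.1) hpq.2
        simpa [mul_comm] using this
      refine hcard.trans (hX.trans (Finset.card_le_card ?_))
      intro v hv
      obtain ⟨x, hx, hxv⟩ := mem_nbhd.mp hv
      obtain ⟨p, hp, rfl⟩ := Finset.mem_image.mp hx
      exact Finset.mem_biUnion.mpr ⟨p, hp, mem_cells.mpr hxv⟩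
    obtain ⟨f, hf, hfc⟩ := hall
    let own (x : B) (j : Fin 7) : Bool := decide (∃ i, f (x, i) = (j, h x j))
    have own_card (x : B) : 5 ≤ (Finset.univ.filter fun j => own x j = true).card := by
      have : (Finset.univ : Finset (Fin 5)).card ≤
          (Finset.univ.filter fun j => own x j = true).card := by
        refine Finset.card_le_card_of_injOn (fun i => (f (x, i)).1) ?_ ?_
        · intro i _
          have hc := mem_cells.mp (hfc (x, i))
          simp only [Finset.coe_filter, Finset.mem_univ, true_and, Set.mem_ofPred_eq, own,
            decide_eq_true_eq]
          exact ⟨i, Prod.ext rfl hc.symm⟩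
        · intro i _ i' _ hii
          have hc := mem_cells.mp (hfc (x, i))
          have hc' := mem_cells.mp (hfc (x, i'))
          simp only at hii hc hc'
          have : f (x, i) = f (x, i') := Prod.ext hii (by rw [← hc, ← hc', hii])
          exact (Prod.ext_iff.mp (hf this)).2
      simpa using this
    let σ : Fin 7 × Fin s → Bool := fun v =>
      if H : ∃ p, f p = v then steer (own H.choose.1) (decide ((H.choose.1 : Fin m) ∈ S)) v.1
      else false
    have σ_own (x : B) (j : Fin 7) (hx : own x j = true) :
        σ (j, h x j) = steer (own x) (decide ((x : Fin m) ∈ S)) j := by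
      obtain ⟨i, hi⟩ := of_decide_eq_true hx
      have H : ∃ p, f p = (j, h x j) := ⟨_, hi⟩
      have : H.choose = (x, i) := hf (H.choose_spec.trans hi.symm)
      simp only [σ, dif_pos H, this]
    refine ⟨σ, fun u => ?_⟩
    by_cases hu : u ∈ B
    · exact answer_eq_of_steer (own ⟨u, hu⟩) _ _ (own_card _) fun j hj => σ_own ⟨u, hu⟩ j hj
    · have hdisj : ∀ j, (j, h u j) ∉ nbhd h S := by
        intro j hj
        exact hu (Finset.mem_filter.mpr ⟨Finset.mem_univ _, j, hj⟩)
      have huS : u ∉ S := fun hS' => hdisj 0 (mem_nbhd.mpr ⟨u, hS', rfl⟩)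
      have leaf (j : Fin 7) (hj : 3 ≤ j) : σ (j, h u j) = false := by
        by_cases H : ∃ p, f p = (j, h u j)
        · simp only [σ, dif_pos H, steer_leaf _ _ hj, decide_eq_false_iff_not]
          intro hS'
          have hc := hfc H.choose
          rw [H.choose_spec] at hc
          exact hdisj j (mem_nbhd.mpr ⟨_, hS', mem_cells.mp hc⟩)
        · simp only [σ, dif_neg H]
      simp [answer, leaf 3 (by decide), leaf 4 (by decide), leaf 5 (by decide),
        leaf 6 (by decide), huS]
  let σ : Finset (Fin m) → Fin 7 × Fin s → Bool := fun S =>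
    if hS : S.card ≤ n then (key S hS).choose else fun _ => false
  refine ⟨fun S i => σ S (finProdFinEquiv.symm i),
    fun u => queryTree fun j => finProdFinEquiv (j, h u j), fun u => queryTree_depth _, ?_⟩
  intro S hS u
  rw [queryTree_eval]
  simp only [Equiv.symm_apply_apply, σ, dif_pos hS, (key S hS).choose_spec u, decide_eq_true_eq]

lemma schemeExists_self (m n : ℕ) : SchemeExists m n m 3 := by
  refine ⟨fun S u => decide (u ∈ S), fun u => .node u (.leaf false) (.leaf true), ?_, ?_⟩
  · intro u; simp [DTree.depth]
  · intro S _ u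
    by_cases hu : u ∈ S <;> simp [DTree.eval, hu]

open Classical in
/-- The proportion of the points of a finite type that satisfy `P`. -/
noncomputable def proportion {Ω : Type*} [Fintype Ω] (P : Ω → Prop) : ℝ :=
  ((Finset.univ.filter P).card : ℝ) / Fintype.card Ω

section Proportion

variable {Ω : Type*} [Fintype Ω]

lemma proportion_nonneg (P : Ω → Prop) : 0 ≤ proportion P := by
  unfold proportion; positivity

lemma proportion_mono {P R : Ω → Prop} (h : ∀ ω, P ω → R ω) : proportion P ≤ proportion R := by
  unfold proportion
  gcongr ?_ / _
  refine Nat.cast_le.mpr (Finset.card_le_card fun ω hω => ?_)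
  simpa using h ω (by simpa using hω)

lemma proportion_exists_le {ι : Type*} (I : Finset ι) (P : ι → Ω → Prop) :
    proportion (fun ω => ∃ i ∈ I, P i ω) ≤ ∑ i ∈ I, proportion (P i) := by
  classical
  unfold proportion
  rw [← Finset.sum_div, ← Nat.cast_sum]
  gcongr
  refine le_trans (Finset.card_le_card ?_) Finset.card_biUnion_le
  intro ω hω
  simpa using hω

lemma proportion_exists_le_card_mul {ι : Type*} (I : Finset ι) (P : ι → Ω → Prop) {c : ℝ}
    (h : ∀ i ∈ I, proportion (P i) ≤ c) :
    proportion (fun ω => ∃ i ∈ I, P i ω) ≤ I.card * c := by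
  refine (proportion_exists_le I P).trans ?_
  simpa using Finset.sum_le_card_nsmul I _ c h

lemma proportion_or_le (P R : Ω → Prop) :
    proportion (fun ω => P ω ∨ R ω) ≤ proportion P + proportion R := by
  classical
  unfold proportion
  rw [← add_div, ← Nat.cast_add]
  gcongr
  refine le_trans (Finset.card_le_card ?_) (Finset.card_union_le _ _)
  intro ω hω
  simpa using hω

lemma proportion_const_and_le (p : Prop) (P : Ω → Prop) {c : ℝ} (hc : 0 ≤ c)
    (h : p → proportion P ≤ c) : proportion (fun ω => p ∧ P ω) ≤ c := by
  by_cases hp : p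
  · simpa [hp] using h hp
  · simpa [hp, proportion] using hc

lemma exists_not_of_proportion_lt_one [Nonempty Ω] {P : Ω → Prop} (h : proportion P < 1) :
    ∃ ω, ¬ P ω := by
  by_contra! H
  simp [proportion, H] at h

lemma proportion_pi {ι β : Type*} [Fintype ι] [DecidableEq ι] [Fintype β]
    (A : ι → β → Prop) :
    proportion (fun h : ι → β => ∀ i, A i (h i)) = ∏ i, proportion (A i) := by
  classical
  unfold proportion
  rw [Finset.prod_div_distrib, ← Nat.cast_prod, ← Fintype.card_piFinset]
  congr 2
  · congr 2
    ext h
    simp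
  · simp

lemma proportion_forall_mem {ι β : Type*} [Fintype ι] [DecidableEq ι] [Fintype β] [Nonempty β]
    (W : Finset ι) (G : β → Prop) :
    proportion (fun h : ι → β => ∀ w ∈ W, G (h w)) = proportion G ^ W.card := by
  rw [proportion_pi fun i b => i ∈ W → G b, ← Finset.prod_const, ← Finset.prod_subset W.subset_univ]
  · exact Finset.prod_congr rfl fun i hi => by simp [hi]
  · intro i _ hi
    simp [hi, proportion]

end Proportion

section Tuples

variable {s : ℕ}

lemma proportion_slice_le (Y : Finset (Fin 7 × Fin s)) (j : Fin 7) :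
    proportion (fun b : Fin s => (j, b) ∈ Y) ≤ Y.card / s := by
  classical
  unfold proportion
  rw [Fintype.card_fin]
  gcongr
  refine Finset.card_le_card_of_injOn (fun b => (j, b)) ?_ ?_
  · intro b hb
    simpa using hb
  · intro b _ b' _ h
    simpa using h

lemma proportion_inside_le (Y : Finset (Fin 7 × Fin s)) :
    proportion (fun g : Fin 7 → Fin s => ∀ j, (j, g j) ∈ Y) ≤ ((Y.card : ℝ) / s) ^ 7 := by
  rw [proportion_pi fun j b => (j, b) ∈ Y]
  calc ∏ j : Fin 7, proportion (fun b : Fin s => (j, b) ∈ Y)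
      ≤ ∏ _j : Fin 7, (Y.card : ℝ) / s :=
        Finset.prod_le_prod (fun _ _ => proportion_nonneg _) fun j _ => proportion_slice_le Y j
    _ = _ := by simp [div_pow]

/-- All the cells of a tuple lie in `Q ∪ Y`, at least one of them in `Q`. -/
def Touches (Q Y : Finset (Fin 7 × Fin s)) (g : Fin 7 → Fin s) : Prop :=
  (∃ j, (j, g j) ∈ Q) ∧ ∀ j, (j, g j) ∈ Q ∪ Y

lemma proportion_touches_le (Q Y : Finset (Fin 7 × Fin s)) :
    proportion (Touches Q Y) ≤ 7 * ((Q.card : ℝ) / s * (((Q ∪ Y).card : ℝ) / s) ^ 6) := by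
  have step : ∀ j : Fin 7,
      proportion (fun g : Fin 7 → Fin s => ∀ i, (i, g i) ∈ if i = j then Q else Q ∪ Y) ≤
        (Q.card : ℝ) / s * (((Q ∪ Y).card : ℝ) / s) ^ 6 := by
    intro j
    rw [proportion_pi fun i b => (i, b) ∈ if i = j then Q else Q ∪ Y]
    calc _ ≤ ∏ i : Fin 7, ((if i = j then Q else Q ∪ Y).card : ℝ) / s :=
          Finset.prod_le_prod (fun _ _ => proportion_nonneg _) fun i _ => proportion_slice_le _ i
      _ = _ := by
          rw [← Finset.mul_prod_erase _ _ (Finset.mem_univ j), if_pos rfl]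
          congr 1
          rw [Finset.prod_congr rfl (g := fun _ => ((Q ∪ Y).card : ℝ) / s)]
          · simp [div_pow]
          · intro i hi
            rw [if_neg (Finset.ne_of_mem_erase hi)]
  have h := proportion_exists_le_card_mul (Finset.univ : Finset (Fin 7)) _ fun j _ => step j
  refine (proportion_mono ?_).trans (h.trans (by simp))
  rintro g ⟨⟨j, hj⟩, hg⟩
  refine ⟨j, Finset.mem_univ _, fun i => ?_⟩
  split_ifs with hij
  · rw [hij]; exact hj
  · exact hg i

end Tuples

lemma choose_le_three_mul_div_pow (a : ℕ) {k : ℕ} (hk : 0 < k) :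
    (a.choose k : ℝ) ≤ (3 * a / k) ^ k := by
  have hk' : (0 : ℝ) < k := by exact_mod_cast hk
  have hf : (0 : ℝ) < k.factorial := by exact_mod_cast k.factorial_pos
  have h1 : (k : ℝ) ^ k / k.factorial ≤ 3 ^ k := by
    refine (Real.pow_div_factorial_le_exp (k : ℝ) hk'.le k).trans ?_
    rw [← mul_one (k : ℝ), Real.exp_nat_mul]
    exact pow_le_pow_left₀ (Real.exp_pos 1).le (Real.exp_one_lt_d9.le.trans (by norm_num)) k
  calc (a.choose k : ℝ) ≤ (a : ℝ) ^ k / k.factorial := Nat.choose_le_pow_div k a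
    _ = (a / k : ℝ) ^ k * ((k : ℝ) ^ k / k.factorial) := by
      rw [div_pow]; field_simp
    _ ≤ (a / k : ℝ) ^ k * 3 ^ k := by gcongr
    _ = (3 * a / k) ^ k := by rw [← mul_pow]; congr 1; ring

section Events

variable {m s : ℕ}

/-- Some `k` elements have all their cells inside a set of size `5 * k`. -/
def Crowded (k : ℕ) (h : Fin m → Fin 7 → Fin s) : Prop :=
  ∃ W ∈ Finset.powersetCard k (Finset.univ : Finset (Fin m)),
    ∃ Y ∈ Finset.powersetCard (5 * k) (Finset.univ : Finset (Fin 7 × Fin s)),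
      ∀ w ∈ W, ∀ j, (j, h w j) ∈ Y

/-- Some `k` elements touch a set of `7 * n` cells and are otherwise confined to a member
of the family `F`. -/
def CrowdedNear (n k : ℕ) (F : Finset (Finset (Fin 7 × Fin s)))
    (h : Fin m → Fin 7 → Fin s) : Prop :=
  ∃ Q ∈ Finset.powersetCard (7 * n) (Finset.univ : Finset (Fin 7 × Fin s)),
    ∃ W ∈ Finset.powersetCard k (Finset.univ : Finset (Fin m)),
      ∃ Y ∈ F, ∀ w ∈ W, Touches Q Y (h w)

lemma proportion_crowded_le (hs : 0 < s) {k : ℕ} (hk : 0 < k) :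
    proportion (Crowded (m := m) (s := s) k) ≤ (3 * 21 ^ 5 * 25 * (m * k / s ^ 2 : ℝ)) ^ k := by
  have : Nonempty (Fin s) := ⟨⟨0, hs⟩⟩
  have hk' : (0 : ℝ) < k := by exact_mod_cast hk
  have hs' : (0 : ℝ) < s := by exact_mod_cast hs
  have h : proportion (Crowded (m := m) (s := s) k) ≤
      m.choose k * ((7 * s).choose (5 * k) * (((5 * k : ℕ) / s : ℝ) ^ 7) ^ k) := by
    refine (proportion_exists_le_card_mul _ _ (c := (7 * s).choose (5 * k) *
      (((5 * k : ℕ) / s : ℝ) ^ 7) ^ k) fun W hW => ?_).trans (by simp)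
    refine (proportion_exists_le_card_mul _ _ (c := (((5 * k : ℕ) / s : ℝ) ^ 7) ^ k)
      fun Y hY => ?_).trans (by simp)
    rw [proportion_forall_mem W fun g : Fin 7 → Fin s => ∀ j, (j, g j) ∈ Y,
      (Finset.mem_powersetCard.mp hW).2]
    have := proportion_inside_le Y
    rw [(Finset.mem_powersetCard.mp hY).2] at this
    exact pow_le_pow_left₀ (proportion_nonneg _) this k
  have hm := choose_le_three_mul_div_pow m hk
  have hv := choose_le_three_mul_div_pow (7 * s) (k := 5 * k) (by omega)
  calc _ ≤ _ := h
    _ ≤ (3 * m / k : ℝ) ^ k * ((3 * (7 * s : ℕ) / (5 * k : ℕ) : ℝ) ^ (5 * k) *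
        (((5 * k : ℕ) / s : ℝ) ^ 7) ^ k) := by gcongr
    _ = _ := by
      rw [pow_mul, ← mul_pow, ← mul_pow]
      congr 1
      push_cast
      field_simp
      ring

lemma proportion_crowdedNear_le (hs : 0 < s) {n k : ℕ} (F : Finset (Finset (Fin 7 × Fin s)))
    {c : ℝ}
    (hc : ∀ Q Y : Finset (Fin 7 × Fin s), Q.card = 7 * n → Y ∈ F → ((Q ∪ Y).card : ℝ) ≤ c) :
    proportion (CrowdedNear (m := m) n k F) ≤
      (7 * s).choose (7 * n) * (m.choose k * (F.card * (49 * n / s * (c / s) ^ 6) ^ k)) := by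
  have : Nonempty (Fin s) := ⟨⟨0, hs⟩⟩
  refine (proportion_exists_le_card_mul _ _ (c := m.choose k *
    (F.card * (49 * n / s * (c / s) ^ 6) ^ k)) fun Q hQ => ?_).trans (by simp)
  refine (proportion_exists_le_card_mul _ _ (c := F.card * (49 * n / s * (c / s) ^ 6) ^ k)
    fun W hW => ?_).trans (by simp)
  refine proportion_exists_le_card_mul _ _ fun Y hY => ?_
  rw [proportion_forall_mem W (Touches Q Y), (Finset.mem_powersetCard.mp hW).2]
  refine pow_le_pow_left₀ (proportion_nonneg _) ((proportion_touches_le Q Y).trans ?_) k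
  have hQ' := (Finset.mem_powersetCard.mp hQ).2
  have := hc Q Y hQ' hY
  rw [hQ']
  calc 7 * (((7 * n : ℕ) : ℝ) / s * (((Q ∪ Y).card : ℝ) / s) ^ 6)
      ≤ 7 * (((7 * n : ℕ) : ℝ) / s * (c / s) ^ 6) := by gcongr
    _ = _ := by push_cast; ring

lemma proportion_crowdedNear_powersetCard_le (hs : 0 < s) {n k : ℕ} (hk : 0 < k) (hnk : n ≤ k)
    (hQ : ((7 * s).choose (7 * n) : ℝ) ≤ (2 ^ 21) ^ k) :
    proportion (CrowdedNear (m := m) (s := s) n k (Finset.powersetCard (5 * k) Finset.univ)) ≤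
      (2 ^ 21 * 3 * (21 / 5) ^ 5 * 49 * 12 ^ 6 * (m * n / s ^ 2 : ℝ)) ^ k := by
  have hk' : (0 : ℝ) < k := by exact_mod_cast hk
  have hs' : (0 : ℝ) < s := by exact_mod_cast hs
  have h := proportion_crowdedNear_le (m := m) hs (n := n) (k := k) (c := 12 * k)
    (Finset.powersetCard (5 * k) Finset.univ)
    (fun Q Y hQ hY => by
      have := Finset.card_union_le Q Y
      rw [hQ, (Finset.mem_powersetCard.mp hY).2] at this
      have : (Q ∪ Y).card ≤ 12 * k := by omega
      exact_mod_cast this)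
  have hm := choose_le_three_mul_div_pow m hk
  have hv := choose_le_three_mul_div_pow (7 * s) (k := 5 * k) (by omega)
  rw [Finset.card_powersetCard, Finset.card_univ, Fintype.card_prod, Fintype.card_fin,
    Fintype.card_fin] at h
  calc _ ≤ _ := h
    _ ≤ (2 ^ 21) ^ k * ((3 * m / k : ℝ) ^ k * ((3 * (7 * s : ℕ) / (5 * k : ℕ) : ℝ) ^ (5 * k) *
        (49 * n / s * (12 * k / s) ^ 6) ^ k)) := by gcongr
    _ = _ := by
      rw [pow_mul, ← mul_pow, ← mul_pow, ← mul_pow]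
      congr 1
      push_cast
      field_simp
      ring

lemma proportion_crowdedNear_univ_le (hs : 0 < s) {n : ℕ}
    (hQ : ((7 * s).choose (7 * n) : ℝ) ≤ (2 ^ 21) ^ s) :
    proportion (CrowdedNear (m := m) (s := s) n s {Finset.univ}) ≤
      (2 ^ 21 * 3 * 49 * 7 ^ 6 * (m * n / s ^ 2 : ℝ)) ^ s := by
  have hs' : (0 : ℝ) < s := by exact_mod_cast hs
  have h := proportion_crowdedNear_le (m := m) hs (n := n) (k := s) (c := 7 * s)
    {Finset.univ} (fun Q Y _ _ => by
      have : (Q ∪ Y).card ≤ 7 * s := by simpa using (Q ∪ Y).card_le_univ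
      exact_mod_cast this)
  have hm := choose_le_three_mul_div_pow m hs
  calc _ ≤ _ := h
    _ ≤ (2 ^ 21) ^ s * ((3 * m / s : ℝ) ^ s * (1 * (49 * n / s * (7 * s / s) ^ 6) ^ s)) := by
      rw [Finset.card_singleton, Nat.cast_one]
      gcongr
    _ = _ := by
      rw [one_mul, ← mul_pow, ← mul_pow]
      congr 1
      field_simp

end Events

lemma exists_admissible {m n s : ℕ} {N : ℝ} (hn : 1 ≤ n) (hnN : n ≤ N) (hsm : s ≤ m)
    (hmN : 10 ^ 20 * (m * N) ≤ (s : ℝ) ^ 2) (hNs : 10 ^ 20 * N ≤ s)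
    (hQ : ∀ k : ℕ, N ≤ k → ((7 * s).choose (7 * n) : ℝ) ≤ (2 ^ 21) ^ k) :
    ∃ h : Fin m → Fin 7 → Fin s, Admissible n h := by
  have hn' : (1 : ℝ) ≤ n := by exact_mod_cast hn
  have hs' : (0 : ℝ) < s := by linarith
  have hs : 0 < s := by exact_mod_cast hs'
  have hx : (m * N / s ^ 2 : ℝ) ≤ 1 / 10 ^ 20 := by
    rw [div_le_div_iff₀ (by positivity) (by positivity)]; linarith
  have hmn : (m * n / s ^ 2 : ℝ) ≤ 1 / 10 ^ 20 := le_trans (by gcongr) hx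
  let bad (k : ℕ) (h : Fin m → Fin 7 → Fin s) : Prop :=
    (k ≤ 2 * N ∧ Crowded k h) ∨
      ((N ≤ k ∧ CrowdedNear n k (Finset.powersetCard (5 * k) Finset.univ) h) ∨
        (k = s ∧ CrowdedNear n k {Finset.univ} h))
  have hbad : ∀ k ∈ Finset.Icc 1 m, proportion (bad k) ≤ (1 / 2) ^ k := by
    intro k hk
    have hk0 : 0 < k := (Finset.mem_Icc.mp hk).1
    have h1 : proportion (fun h : Fin m → Fin 7 → Fin s => (k : ℝ) ≤ 2 * N ∧ Crowded k h) ≤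
        (1 / 8) ^ k := by
      refine proportion_const_and_le _ _ (by positivity) fun hkN => ?_
      refine (proportion_crowded_le hs hk0).trans (pow_le_pow_left₀ (by positivity) ?_ k)
      have : (m * k / s ^ 2 : ℝ) ≤ 2 * (m * N / s ^ 2) := by
        rw [← mul_div_assoc]
        gcongr ?_ / _
        nlinarith [(Nat.cast_nonneg m : (0 : ℝ) ≤ m)]
      linarith
    have h2 : proportion (fun h : Fin m → Fin 7 → Fin s => N ≤ (k : ℝ) ∧
        CrowdedNear n k (Finset.powersetCard (5 * k) Finset.univ) h) ≤ (1 / 8) ^ k := by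
      refine proportion_const_and_le _ _ (by positivity) fun hkN => ?_
      refine (proportion_crowdedNear_powersetCard_le hs hk0
        (by exact_mod_cast hnN.trans hkN) (hQ k hkN)).trans
        (pow_le_pow_left₀ (by positivity) ?_ k)
      linarith
    have h3 : proportion (fun h : Fin m → Fin 7 → Fin s => k = s ∧
        CrowdedNear n k {Finset.univ} h) ≤ (1 / 8) ^ k := by
      refine proportion_const_and_le _ _ (by positivity) fun hks => ?_
      subst hks
      refine (proportion_crowdedNear_univ_le hs (hQ k (by linarith))).trans
        (pow_le_pow_left₀ (by positivity) ?_ k)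
      linarith
    have h4 : (3 : ℝ) ≤ 4 ^ k := by
      calc (3 : ℝ) ≤ 4 ^ 1 := by norm_num
        _ ≤ 4 ^ k := pow_le_pow_right₀ (by norm_num) hk0
    calc proportion (bad k) ≤ (1 / 8) ^ k + ((1 / 8) ^ k + (1 / 8) ^ k) :=
          (proportion_or_le _ _).trans (add_le_add h1 ((proportion_or_le _ _).trans
            (add_le_add h2 h3)))
      _ = 3 * (1 / 8) ^ k := by ring
      _ ≤ 4 ^ k * (1 / 8) ^ k := by gcongr
      _ = (1 / 2) ^ k := by rw [← mul_pow]; norm_num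
  have hsum : ∀ M : ℕ, ∑ k ∈ Finset.Icc 1 M, (1 / 2 : ℝ) ^ k = 1 - (1 / 2) ^ M := by
    intro M
    induction M with
    | zero => simp
    | succ M ih => rw [Finset.sum_Icc_succ_top (by omega), ih]; ring
  have hlt : proportion (fun h => ∃ k ∈ Finset.Icc 1 m, bad k h) < 1 := by
    refine ((proportion_exists_le _ _).trans (Finset.sum_le_sum hbad)).trans_lt ?_
    rw [hsum]
    have : (0 : ℝ) < (1 / 2) ^ m := by positivity
    linarith
  have : Nonempty (Fin s) := ⟨⟨0, hs⟩⟩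
  obtain ⟨h, hh⟩ := exists_not_of_proportion_lt_one hlt
  have hgood : ∀ k, 1 ≤ k → k ≤ m → ¬ bad k h := fun k h1 h2 hb =>
    hh ⟨k, Finset.mem_Icc.mpr ⟨h1, h2⟩, hb⟩
  have card_le_m (X : Finset (Fin m)) : X.card ≤ m := by simpa using X.card_le_univ
  have card_cells : Fintype.card (Fin 7 × Fin s) = 7 * s := by simp
  have small : ∀ X : Finset (Fin m), (X.card : ℝ) ≤ 2 * N → 5 * X.card ≤ (nbhd h X).card := by
    intro X hX
    rcases Nat.eq_zero_or_pos X.card with h0 | h0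
    · simp [h0]
    by_contra! hc
    have hle : 5 * X.card ≤ 7 * s := by
      have : (5 * X.card : ℝ) ≤ 7 * s := by linarith
      exact_mod_cast this
    obtain ⟨Y, hY, hYc⟩ := Finset.exists_superset_card_eq hc.le (by rw [card_cells]; exact hle)
    refine hgood _ h0 (card_le_m X) (Or.inl ⟨hX, X, by simp, Y, by simp [hYc], ?_⟩)
    exact fun w hw j => hY (mem_nbhd.mpr ⟨w, hw, rfl⟩)
  refine ⟨h, fun S hS X hX => ?_⟩
  have hSN : (S.card : ℝ) ≤ N := le_trans (by exact_mod_cast hS) hnN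
  by_cases hXN : (X.card : ℝ) ≤ 2 * N
  · exact small X hXN
  have hns : n ≤ s := by
    have : (n : ℝ) ≤ s := by linarith
    exact_mod_cast this
  have hSc : (nbhd h S).card ≤ 7 * n := by
    calc (nbhd h S).card ≤ S.card * 7 := by
          refine Finset.card_biUnion_le_card_mul _ _ _ fun x _ => ?_
          exact Finset.card_image_le.trans (by simp)
      _ ≤ 7 * n := by omega
  obtain ⟨Q, hSQ, hQc⟩ := Finset.exists_superset_card_eq hSc (by rw [card_cells]; omega)
  have hWX : (X \ S).card + (X ∩ S).card = X.card := Finset.card_sdiff_add_card_inter X S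
  have hXS : (X ∩ S).card ≤ S.card := Finset.card_le_card Finset.inter_subset_right
  have hWN : N ≤ ((X \ S).card : ℝ) := by
    have h1 : ((X \ S).card : ℝ) + (X ∩ S).card = X.card := by exact_mod_cast hWX
    have h2 : ((X ∩ S).card : ℝ) ≤ S.card := by exact_mod_cast hXS
    linarith
  have touch : ∀ w ∈ X \ S, ∃ j, (j, h w j) ∈ Q := fun w hw => by
    obtain ⟨j, hj⟩ := hX w (Finset.mem_sdiff.mp hw).1
    exact ⟨j, hSQ hj⟩
  have hWs : (X \ S).card < s := by
    by_contra! hc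
    obtain ⟨W, hW, hWc⟩ := Finset.exists_subset_card_eq hc
    refine hgood s hs hsm (Or.inr (Or.inr ⟨rfl, Q, by simp [hQc], W, by simp [hWc], Finset.univ,
      by simp, fun w hw => ⟨touch w (hW hw), by simp⟩⟩))
  have hW0 : 1 ≤ (X \ S).card := by
    have : (1 : ℝ) ≤ (X \ S).card := by linarith
    exact_mod_cast this
  have hW : 5 * (X \ S).card ≤ (nbhd h (X \ S) \ Q).card := by
    by_contra! hc
    obtain ⟨Y, hY, hYc⟩ := Finset.exists_superset_card_eq hc.le (by rw [card_cells]; omega)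
    refine hgood _ hW0 (card_le_m _) (Or.inr (Or.inl ⟨hWN, Q, by simp [hQc], X \ S, by simp, Y,
      by simp [hYc], fun w hw => ⟨touch w hw, fun j => ?_⟩⟩))
    by_cases hj : (j, h w j) ∈ Q
    · exact Finset.mem_union_left _ hj
    · exact Finset.mem_union_right _
        (hY (Finset.mem_sdiff.mpr ⟨mem_nbhd.mpr ⟨w, hw, rfl⟩, hj⟩))
  have hI : 5 * (X ∩ S).card ≤ (nbhd h (X ∩ S)).card := by
    refine small _ ?_
    have h2 : ((X ∩ S).card : ℝ) ≤ S.card := by exact_mod_cast hXS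
    linarith
  have hdisj : Disjoint (nbhd h (X \ S) \ Q) (nbhd h (X ∩ S)) := by
    refine Finset.disjoint_of_subset_right ?_ Finset.sdiff_disjoint
    exact (Finset.biUnion_subset_biUnion_of_subset_left _ Finset.inter_subset_right).trans hSQ
  calc 5 * X.card = 5 * (X \ S).card + 5 * (X ∩ S).card := by omega
    _ ≤ (nbhd h (X \ S) \ Q).card + (nbhd h (X ∩ S)).card := add_le_add hW hI
    _ = ((nbhd h (X \ S) \ Q) ∪ nbhd h (X ∩ S)).card := (Finset.card_union_of_disjoint hdisj).symm
    _ ≤ (nbhd h X).card := by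
      refine Finset.card_le_card (Finset.union_subset (Finset.sdiff_subset.trans ?_) ?_)
      · exact Finset.biUnion_subset_biUnion_of_subset_left _ Finset.sdiff_subset
      · exact Finset.biUnion_subset_biUnion_of_subset_left _ Finset.inter_subset_left

/-- There is a constant `C > 0` such that for all sufficiently large `m` and all
integers `n` with `1 ≤ n ≤ m`, `s(m,n,3) ≤ C · √(m · n · log₂(2m/n))`. -/
theorem three_probe_upper_bound :
    ∃ C : ℝ, 0 < C ∧ ∃ M : ℕ, ∀ m : ℕ, M ≤ m → ∀ n : ℕ, 1 ≤ n → n ≤ m →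
      (sFun m n 3 : ℝ) ≤ C * Real.sqrt ((m : ℝ) * (n : ℝ) * Real.logb 2 (2 * (m : ℝ) / (n : ℝ))) := by
  refine ⟨14 * 10 ^ 10, by norm_num, 0, fun m _ n hn hnm => ?_⟩
  set L : ℝ := Real.logb 2 (2 * (m : ℝ) / (n : ℝ)) with hLdef
  set R : ℝ := Real.sqrt ((m : ℝ) * (n : ℝ) * L) with hRdef
  have hn' : (1 : ℝ) ≤ n := by exact_mod_cast hn
  have hnm' : (n : ℝ) ≤ m := by exact_mod_cast hnm
  have hm' : (1 : ℝ) ≤ m := hn'.trans hnm'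
  have hdiv : (2 : ℝ) ≤ 2 * m / n := by
    rw [le_div_iff₀ (by linarith)]; linarith
  have hL : 1 ≤ L := by
    rw [hLdef, Real.le_logb_iff_rpow_le (by norm_num) (by linarith)]
    simpa using hdiv
  have hmn : (1 : ℝ) ≤ m * n := one_le_mul_of_one_le_of_one_le hm' hn'
  have hmnL : (1 : ℝ) ≤ m * n * L := one_le_mul_of_one_le_of_one_le hmn hL
  have hR : 1 ≤ R := Real.one_le_sqrt.mpr hmnL
  have hR2 : R ^ 2 = m * n * L := Real.sq_sqrt (by linarith)
  set s : ℕ := ⌈10 ^ 10 * R⌉₊ with hsdef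
  have hs1 : 10 ^ 10 * R ≤ s := Nat.le_ceil _
  have hs2 : (s : ℝ) < 10 ^ 10 * R + 1 := Nat.ceil_lt_add_one (by positivity)
  rcases le_or_gt m s with hms | hsm
  · have h1 : sFun m n 3 ≤ m := Nat.sInf_le (schemeExists_self m n)
    have h2 : (sFun m n 3 : ℝ) ≤ s := by exact_mod_cast h1.trans hms
    linarith
  have hsm' : (s : ℝ) < m := by exact_mod_cast hsm
  have hs0 : (0 : ℝ) < s := by linarith
  have hmN : 10 ^ 20 * (m * (n * L)) ≤ (s : ℝ) ^ 2 := by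
    calc (10 : ℝ) ^ 20 * (m * (n * L)) = (10 ^ 10 * R) ^ 2 := by rw [mul_pow, hR2]; ring
      _ ≤ (s : ℝ) ^ 2 := by gcongr
  have hNs : 10 ^ 20 * (n * L) ≤ (s : ℝ) := by
    have : (m : ℝ) * (10 ^ 20 * (n * L)) ≤ m * s := by nlinarith
    exact le_of_mul_le_mul_left this (by linarith)
  have hQ : ∀ k : ℕ, n * L ≤ (k : ℝ) → ((7 * s).choose (7 * n) : ℝ) ≤ (2 ^ 21) ^ k := by
    intro k hk
    have h2L : (2 : ℝ) ^ L = 2 * m / n :=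
      Real.rpow_logb (by norm_num) (by norm_num) (by linarith)
    have hbase : (3 * (7 * s : ℕ) / (7 * n : ℕ) : ℝ) ≤ (2 : ℝ) ^ (3 * L) := by
      calc (3 * (7 * s : ℕ) / (7 * n : ℕ) : ℝ) = 3 * s / n := by push_cast; field_simp
        _ ≤ 2 ^ 2 * (2 * m / n) := by
          rw [← mul_div_assoc]
          gcongr ?_ / _
          linarith
        _ = (2 : ℝ) ^ (2 + L) := by
          rw [Real.rpow_add (by norm_num), h2L]; norm_num
        _ ≤ (2 : ℝ) ^ (3 * L) := Real.rpow_le_rpow_of_exponent_le (by norm_num) (by linarith)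
    calc ((7 * s).choose (7 * n) : ℝ)
        ≤ (3 * (7 * s : ℕ) / (7 * n : ℕ) : ℝ) ^ (7 * n) :=
          choose_le_three_mul_div_pow _ (by omega)
      _ ≤ ((2 : ℝ) ^ (3 * L)) ^ (7 * n) := by gcongr
      _ = (2 : ℝ) ^ (21 * (n * L)) := by
          rw [← Real.rpow_natCast, ← Real.rpow_mul (by norm_num)]
          congr 1
          push_cast
          ring
      _ ≤ (2 : ℝ) ^ (21 * k : ℝ) :=
          Real.rpow_le_rpow_of_exponent_le (by norm_num) (by linarith)
      _ = (2 ^ 21) ^ k := by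
          rw [← pow_mul, ← Real.rpow_natCast]; push_cast; rfl
  obtain ⟨h, hh⟩ := exists_admissible (N := n * L) hn (by nlinarith) hsm.le hmN hNs hQ
  have h1 : sFun m n 3 ≤ 7 * s := Nat.sInf_le hh.schemeExists
  have h2 : (sFun m n 3 : ℝ) ≤ 7 * s := by exact_mod_cast h1
  linarith
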